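/- Let (X,d) be a compact metric space, T : X → X a continuous map, and φ ∈ C(X,ℝ). Then the maximum ergodic average satisfies α(φ) = sup_{x∈X} liminf_{n→∞} S_nφ(x)/n. -/

import Mathlib

open MeasureTheory Filter Topology

/-- The Birkhoff sum `S_n φ(x) = ∑_{i=0}^{n-1} φ(T^i x)`. -/
noncomputable def birkhoffAvgSum {X : Type*} [TopologicalSpace X] (T : X → X) (φ : C(X, ℝ)) (n : ℕ) (x : X) : ℝ :=
  ∑ i ∈ Finset.range n, φ (T^[i] x)

/-- The maximum ergodic average `α(φ) = sup_{μ ∈ M_T(X)} ∫ φ dμ`. -/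
noncomputable def maxErgAvg {X : Type*} [MetricSpace X] [MeasurableSpace X] [BorelSpace X]
    (T : X → X) (φ : C(X, ℝ)) : ℝ :=
  sSup {r : ℝ | ∃ μ : Measure X, IsProbabilityMeasure μ ∧ μ.map T = μ ∧ r = ∫ x, φ x ∂μ}


section Helpers

variable {X : Type*} [MetricSpace X] [CompactSpace X]

lemma bas_abs_le (T : X → X) (φ : C(X, ℝ)) (n : ℕ) (x : X) :
    |birkhoffAvgSum T φ n x| ≤ n * ‖φ‖ := by
  unfold birkhoffAvgSum
  refine (Finset.abs_sum_le_sum_abs _ _).trans ?_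
  refine (Finset.sum_le_sum (fun i _ => φ.norm_coe_le_norm (T^[i] x))).trans ?_
  simp

lemma bas_div_abs_le (T : X → X) (φ : C(X, ℝ)) (n : ℕ) (x : X) :
    |birkhoffAvgSum T φ n x / n| ≤ ‖φ‖ := by
  rcases Nat.eq_zero_or_pos n with rfl | hn
  · simp
  · have hn' : (0 : ℝ) < n := by exact_mod_cast hn
    rw [abs_div, abs_of_pos hn', div_le_iff₀ hn', mul_comm]
    exact bas_abs_le T φ n x

lemma bas_add (T : X → X) (φ : C(X, ℝ)) (m n : ℕ) (x : X) :
    birkhoffAvgSum T φ (m + n) x = birkhoffAvgSum T φ m x + birkhoffAvgSum T φ n (T^[m] x) := by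
  unfold birkhoffAvgSum
  rw [Finset.sum_range_add]
  congr 1
  refine Finset.sum_congr rfl fun i _ => ?_
  rw [← Function.iterate_add_apply, add_comm]

lemma bas_continuous (T : X → X) (hT : Continuous T) (φ : C(X, ℝ)) (n : ℕ) :
    Continuous (birkhoffAvgSum T φ n) := by
  unfold birkhoffAvgSum
  exact continuous_finset_sum _ fun i _ => φ.continuous.comp (hT.iterate i)

lemma bas_bddBelow (T : X → X) (φ : C(X, ℝ)) (x : X) :
    IsBoundedUnder (· ≥ ·) atTop (fun n : ℕ => birkhoffAvgSum T φ n x / n) :=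
  isBoundedUnder_of ⟨-‖φ‖, fun n => (abs_le.1 (bas_div_abs_le T φ n x)).1⟩

lemma bas_bddAbove (T : X → X) (φ : C(X, ℝ)) (x : X) :
    IsBoundedUnder (· ≤ ·) atTop (fun n : ℕ => birkhoffAvgSum T φ n x / n) :=
  isBoundedUnder_of ⟨‖φ‖, fun n => (abs_le.1 (bas_div_abs_le T φ n x)).2⟩

lemma bas_liminf_le (T : X → X) (φ : C(X, ℝ)) (x : X) :
    liminf (fun n : ℕ => birkhoffAvgSum T φ n x / n) atTop ≤ ‖φ‖ := by
  refine liminf_le_of_frequently_le (Frequently.of_forall fun n => ?_) (bas_bddBelow T φ x)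
  exact (abs_le.1 (bas_div_abs_le T φ n x)).2

/-- If every orbit has a time where the average drops below `c`, Birkhoff sums are at most
`c m + C` uniformly. -/
lemma bas_uniform (T : X → X) (hT : Continuous T) (φ : C(X, ℝ)) (c : ℝ)
    (h : ∀ x, ∃ n : ℕ, 0 < n ∧ birkhoffAvgSum T φ n x < c * n) :
    ∃ C : ℝ, ∀ m x, birkhoffAvgSum T φ m x ≤ c * m + C := by
  choose n hn0 hn using h
  have hopen : ∀ x, IsOpen {y | birkhoffAvgSum T φ (n x) y < c * n x} := fun x =>
    isOpen_lt (bas_continuous T hT φ _) continuous_const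
  obtain ⟨t, ht⟩ := isCompact_univ.elim_finite_subcover
    (fun x => {y | birkhoffAvgSum T φ (n x) y < c * n x}) hopen
    (fun x _ => Set.mem_iUnion.2 ⟨x, hn x⟩)
  let N := t.sup n
  refine ⟨N * (‖φ‖ + |c|), fun m => ?_⟩
  induction m using Nat.strong_induction_on with
  | _ m ih =>
    intro x
    have hb := (abs_le.1 (bas_abs_le T φ m x)).2
    by_cases hm : m < N
    · have h1 : (m : ℝ) ≤ N := by exact_mod_cast hm.le
      have h2 : (m : ℝ) * (‖φ‖ + |c|) ≤ N * (‖φ‖ + |c|) := by gcongr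
      have h3 : -(|c| * m) ≤ c * m := by
        have := neg_abs_le c
        have hm0 : (0 : ℝ) ≤ m := by positivity
        nlinarith
      nlinarith
    · obtain ⟨y, hy, hxy⟩ : ∃ y ∈ t, birkhoffAvgSum T φ (n y) x < c * n y := by
        have := ht (Set.mem_univ x)
        simpa using this
      have hyN : n y ≤ N := Finset.le_sup (f := n) hy
      obtain ⟨k, rfl⟩ : ∃ k, m = n y + k := ⟨m - n y, by omega⟩
      have := ih k (by have := hn0 y; omega) (T^[n y] x)
      rw [bas_add]
      push_cast
      linarith

variable [MeasurableSpace X] [BorelSpace X]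

lemma integral_bas (T : X → X) (hT : Continuous T) (φ : C(X, ℝ)) (μ : Measure X)
    [IsProbabilityMeasure μ] (hμ : μ.map T = μ) (n : ℕ) :
    ∫ x, birkhoffAvgSum T φ n x ∂μ = n * ∫ x, φ x ∂μ := by
  unfold birkhoffAvgSum
  have hmp : MeasurePreserving T μ μ := ⟨hT.measurable, hμ⟩
  rw [integral_finset_sum]
  · have : ∀ i ∈ Finset.range n, ∫ x, φ (T^[i] x) ∂μ = ∫ x, φ x ∂μ := fun i _ => by
      have h := (hmp.iterate i)
      rw [← integral_map (f := fun y => φ y) h.measurable.aemeasurable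
        φ.continuous.aestronglyMeasurable, h.map_eq]
    rw [Finset.sum_congr rfl this]
    simp
  · intro i _
    exact (φ.continuous.comp (hT.iterate i)).integrable_of_hasCompactSupport
      (HasCompactSupport.of_compactSpace _)

lemma integral_le_sup (T : X → X) (hT : Continuous T) (φ : C(X, ℝ)) (μ : Measure X)
    [IsProbabilityMeasure μ] (hμ : μ.map T = μ) :
    ∫ x, φ x ∂μ ≤ ⨆ x : X, liminf (fun n : ℕ => birkhoffAvgSum T φ n x / n) atTop := by
  refine le_of_forall_gt_imp_ge_of_dense fun c hc => ?_
  have hbdd : BddAbove (Set.range fun x : X =>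
      liminf (fun n : ℕ => birkhoffAvgSum T φ n x / n) atTop) :=
    ⟨‖φ‖, by rintro _ ⟨x, rfl⟩; exact bas_liminf_le T φ x⟩
  obtain ⟨C, hC⟩ := bas_uniform T hT φ c (fun x => by
    have hx := (le_ciSup hbdd x).trans_lt hc
    have hf := frequently_lt_of_liminf_lt (bas_bddAbove T φ x).isCoboundedUnder_ge hx
    obtain ⟨n, hn, hn0⟩ := (hf.and_eventually (eventually_gt_atTop 0)).exists
    have hn' : (0 : ℝ) < n := by exact_mod_cast hn0
    exact ⟨n, hn0, (div_lt_iff₀ hn').1 hn⟩)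
  by_contra! hlt
  have key : ∀ m : ℕ, m * (∫ x, φ x ∂μ) ≤ c * m + C := fun m => by
    rw [← integral_bas T hT φ μ hμ m]
    calc ∫ x, birkhoffAvgSum T φ m x ∂μ ≤ ∫ _x, (c * m + C) ∂μ :=
          integral_mono ((bas_continuous T hT φ m).integrable_of_hasCompactSupport
            (HasCompactSupport.of_compactSpace _)) (integrable_const _) (hC m)
      _ = c * m + C := by simp
  obtain ⟨m, hm⟩ := exists_nat_gt (C / ((∫ x, φ x ∂μ) - c))
  rw [div_lt_iff₀ (by linarith)] at hm
  have := key m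
  nlinarith

/-- Empirical measures. -/
noncomputable def empMeas (T : X → X) (x : X) (n : ℕ) : Measure X :=
  ((n + 1 : ℕ) : ENNReal)⁻¹ • ∑ i ∈ Finset.range (n + 1), Measure.dirac (T^[i] x)

lemma empMeas_prob (T : X → X) (x : X) (n : ℕ) : IsProbabilityMeasure (empMeas T x n) := by
  constructor
  simp only [empMeas, Measure.smul_apply, Measure.finsetSum_apply, measure_univ,
    Finset.sum_const, Finset.card_range, smul_eq_mul, nsmul_eq_mul, mul_one]
  exact ENNReal.inv_mul_cancel (by simp) (ENNReal.natCast_ne_top _)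

lemma integral_empMeas (T : X → X) (x : X) (n : ℕ) (f : C(X, ℝ)) :
    ∫ y, f y ∂(empMeas T x n) = birkhoffAvgSum T f (n + 1) x / ((n + 1 : ℕ) : ℝ) := by
  unfold empMeas birkhoffAvgSum
  rw [integral_smul_measure, integral_finset_sum_measure]
  · simp only [integral_dirac, ENNReal.toReal_inv, ENNReal.toReal_natCast, smul_eq_mul]
    rw [div_eq_inv_mul]
  · intro i _
    exact f.continuous.integrable_of_hasCompactSupport (HasCompactSupport.of_compactSpace _)

lemma exists_inv (T : X → X) (hT : Continuous T) (φ : C(X, ℝ)) (x : X) :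
    ∃ μ : Measure X, IsProbabilityMeasure μ ∧ μ.map T = μ ∧
      liminf (fun n : ℕ => birkhoffAvgSum T φ n x / n) atTop ≤ ∫ y, φ y ∂μ := by
  let P : ℕ → ProbabilityMeasure X := fun n => ⟨empMeas T x n, empMeas_prob T x n⟩
  let U : Ultrafilter ℕ := hyperfilter ℕ
  have hU : (U : Filter ℕ) ≤ atTop := Nat.hyperfilter_le_atTop
  obtain ⟨Q, -, hQ⟩ := isCompact_univ.ultrafilter_le_nhds (U.map P) (by simp)
  have hQ' : Tendsto P U (𝓝 Q) := hQ
  have hint : ∀ f : C(X, ℝ), Tendsto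
      (fun n : ℕ => birkhoffAvgSum T f (n + 1) x / ((n + 1 : ℕ) : ℝ)) U
      (𝓝 (∫ y, f y ∂(Q : Measure X))) := fun f => by
    have := (ProbabilityMeasure.tendsto_iff_forall_integral_tendsto.1 hQ')
      (BoundedContinuousFunction.mkOfCompact f)
    refine this.congr fun n => ?_
    exact integral_empMeas T x n f
  refine ⟨Q, inferInstance, ?_, ?_⟩
  · have : IsProbabilityMeasure ((Q : Measure X).map T) :=
      Measure.isProbabilityMeasure_map hT.measurable.aemeasurable
    refine ext_of_forall_integral_eq_of_IsFiniteMeasure fun f => ?_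
    rw [integral_map hT.measurable.aemeasurable f.continuous.aestronglyMeasurable]
    let g : C(X, ℝ) := f.toContinuousMap
    let gT : C(X, ℝ) := g.comp ⟨T, hT⟩
    have h1 := (hint gT).sub (hint g)
    have h2 : Tendsto (fun n : ℕ => birkhoffAvgSum T gT (n + 1) x / ((n + 1 : ℕ) : ℝ)
        - birkhoffAvgSum T g (n + 1) x / ((n + 1 : ℕ) : ℝ)) U (𝓝 0) := by
      have hz : Tendsto (fun n : ℕ => (2 * ‖g‖) * (1 / ((n : ℝ) + 1))) U (𝓝 0) := by
        have := (tendsto_one_div_add_atTop_nhds_zero_nat (𝕜 := ℝ)).const_mul (2 * ‖g‖)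
        rw [mul_zero] at this
        exact this.mono_left hU
      refine squeeze_zero_norm (fun n => ?_) hz
      have e : birkhoffAvgSum T gT (n + 1) x - birkhoffAvgSum T g (n + 1) x
          = g (T^[n + 1] x) - g x := by
        unfold birkhoffAvgSum
        have : ∀ i, gT (T^[i] x) = g (T^[i + 1] x) := fun i => by
          rw [Function.iterate_succ_apply']; rfl
        simp only [this]
        rw [← Finset.sum_sub_distrib, Finset.sum_range_sub (fun i => g (T^[i] x))]
        rfl
      rw [← sub_div, e, norm_div]
      have hn : ‖((n + 1 : ℕ) : ℝ)‖ = (n : ℝ) + 1 := by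
        rw [Real.norm_natCast]; push_cast; rfl
      rw [hn, div_eq_mul_one_div]
      gcongr
      refine (norm_sub_le _ _).trans ?_
      linarith [g.norm_coe_le_norm (T^[n + 1] x), g.norm_coe_le_norm x]
    exact sub_eq_zero.1 (tendsto_nhds_unique h1 h2)
  · refine le_of_forall_lt_imp_le_of_dense fun c hc => ?_
    have hev := eventually_lt_of_lt_liminf hc (bas_bddBelow T φ x)
    have hev' := (tendsto_add_atTop_nat 1).eventually hev
    exact ge_of_tendsto (hint φ) ((hev'.filter_mono hU).mono fun n hn => le_of_lt hn)

end Helpers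

/-- `α(φ) = sup_{x∈X} liminf_{n→∞} S_nφ(x)/n`. -/
theorem maxErgAvg_eq_sup_liminf {X : Type*} [MetricSpace X] [CompactSpace X] [Nonempty X]
    [MeasurableSpace X] [BorelSpace X] (T : X → X) (hT : Continuous T) (φ : C(X, ℝ)) :
    maxErgAvg T φ =
      ⨆ x : X, liminf (fun n : ℕ => birkhoffAvgSum T φ n x / n) atTop := by
  have hub : ∀ r ∈ {r : ℝ | ∃ μ : Measure X, IsProbabilityMeasure μ ∧ μ.map T = μ ∧
      r = ∫ x, φ x ∂μ},
      r ≤ ⨆ x : X, liminf (fun n : ℕ => birkhoffAvgSum T φ n x / n) atTop := by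
    rintro r ⟨μ, hp, hμ, rfl⟩
    exact integral_le_sup T hT φ μ hμ
  unfold maxErgAvg
  apply le_antisymm
  · obtain ⟨μ, hp, hμ, -⟩ := exists_inv T hT φ (Classical.arbitrary X)
    exact csSup_le ⟨_, μ, hp, hμ, rfl⟩ hub
  · refine ciSup_le fun x => ?_
    obtain ⟨μ, hp, hμ, hle⟩ := exists_inv T hT φ x
    exact hle.trans (le_csSup ⟨_, hub⟩ ⟨μ, hp, hμ, rfl⟩)
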